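/- arXiv:2506.22631 — 5 statements merged into one kernel-verified Lean document; each statement's English description precedes it below -/
import Mathlib

section
/- For every α ∈ L²(P) and every x ∈ X: (i) E(⟨ŵ_α, Φ_m(x)⟩ − f_α(x))² ≤ a² ‖α‖²_{L²(P)} / m, and (ii) E‖ŵ_α‖₂² = ‖α‖²_{L²(P)}. -/
open MeasureTheory

/-- The second moment of an `L²` function is its squared norm. -/
lemma integral_sq_coeFn_eq_norm_sq {Θ : Type*} [MeasurableSpace Θ] {P : Measure Θ}
    (α : Lp ℝ 2 P) : ∫ θ, α θ ^ 2 ∂P = ‖α‖ ^ 2 := by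
  rw [← real_inner_self_eq_norm_sq, L2.inner_def]
  simp [sq]

/-- The empirical mean of `m` independent samples of a square-integrable function `g` has mean
squared error at most `𝔼[g²] / m`. -/
lemma integral_sq_empirical_mean_sub_le {Θ : Type*} [MeasurableSpace Θ] {P : Measure Θ}
    [IsProbabilityMeasure P] {g : Θ → ℝ} (hg : MemLp g 2 P) {m : ℕ} (hm : m ≠ 0) :
    ∫ ω : Fin m → Θ, (∑ i, g (ω i) / m - ∫ θ, g θ ∂P) ^ 2 ∂(Measure.pi fun _ => P) ≤
      (∫ θ, g θ ^ 2 ∂P) / m := by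
  have hm' : (m : ℝ) ≠ 0 := Nat.cast_ne_zero.mpr hm
  have hG : MemLp (fun θ => g θ / m) 2 P := by
    simpa only [div_eq_inv_mul] using hg.const_mul (m : ℝ)⁻¹
  have hGi (i : Fin m) :
      MemLp (fun ω : Fin m → Θ => g (ω i) / m) 2 (Measure.pi fun _ => P) :=
    hG.comp_measurePreserving (measurePreserving_eval _ i)
  have hmean : ∫ ω : Fin m → Θ, ∑ i, g (ω i) / m ∂(Measure.pi fun _ => P) = ∫ θ, g θ ∂P := by
    rw [integral_finsetSum _ fun i _ => (hGi i).integrable one_le_two]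
    have h (i : Fin m) : ∫ ω : Fin m → Θ, g (ω i) / m ∂(Measure.pi fun _ => P) =
        ∫ θ, g θ / m ∂P :=
      integral_comp_eval (μ := fun _ : Fin m => P) hG.aestronglyMeasurable
    simp only [h, integral_div, Finset.sum_const, Finset.card_univ, Fintype.card_fin,
      nsmul_eq_mul]
    field_simp
  have hvar := ProbabilityTheory.variance_sum_pi (μ := fun _ : Fin m => P)
    (X := fun _ θ => g θ / m) fun _ => hG
  rw [ProbabilityTheory.variance_eq_integral
    (Finset.aemeasurable_sum _ fun i _ => (hGi i).aemeasurable)] at hvar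
  simp only [Finset.sum_apply, hmean] at hvar
  rw [hvar]
  calc ∑ _i : Fin m, ProbabilityTheory.variance (fun θ => g θ / m) P
      ≤ ∑ _i : Fin m, ∫ θ, (g θ / m) ^ 2 ∂P :=
        Finset.sum_le_sum fun _ _ =>
          ProbabilityTheory.variance_le_expectation_sq hG.aestronglyMeasurable
    _ = (∫ θ, g θ ^ 2 ∂P) / m := by
        simp only [div_pow, integral_div, Finset.sum_const, Finset.card_univ, Fintype.card_fin,
          nsmul_eq_mul]
        field_simp

/-- For every `α ∈ L²(P)` and `x ∈ X`:
(i) `E(⟨ŵ_α, Φ_m(x)⟩ − f_α(x))² ≤ a² ‖α‖²_{L²(P)} / m`, and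
(ii) `E ‖ŵ_α‖₂² = ‖α‖²_{L²(P)}`. -/
theorem random_feature_estimate_variance_bound_and_norm
    {Θ : Type*} [MeasurableSpace Θ] (P : Measure Θ) [IsProbabilityMeasure P]
    {X : Type*} (a : ℝ) (ha : 0 < a) (φ : X → Θ → ℝ)
    (hmeas : ∀ x, Measurable (φ x)) (hbound : ∀ x θ, |φ x θ| ≤ a)
    (m : ℕ) (hm : 1 ≤ m) (α : Lp ℝ 2 P) (x : X) :
    (∫ ω : Fin m → Θ,
        (∑ i, (α (ω i) / Real.sqrt m) * (φ x (ω i) / Real.sqrt m)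
          - ∫ θ, α θ * φ x θ ∂P) ^ 2
        ∂(Measure.pi fun _ => P)) ≤ a ^ 2 * ‖α‖ ^ 2 / m ∧
    (∫ ω : Fin m → Θ,
        ∑ i, (α (ω i) / Real.sqrt m) ^ 2 ∂(Measure.pi fun _ => P)) = ‖α‖ ^ 2 := by
  have hm0 : m ≠ 0 := Nat.one_le_iff_ne_zero.mp hm
  have hm' : (m : ℝ) ≠ 0 := Nat.cast_ne_zero.mpr hm0
  have hsqrt : Real.sqrt m * Real.sqrt m = m := Real.mul_self_sqrt m.cast_nonneg
  have hα : MemLp α 2 P := Lp.memLp α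
  constructor
  · have hle (θ : Θ) : ‖α θ * φ x θ‖ ≤ a * ‖α θ‖ := by
      rw [norm_mul, mul_comm]
      exact mul_le_mul_of_nonneg_right (hbound x θ) (norm_nonneg _)
    have hg : MemLp (fun θ => α θ * φ x θ) 2 P :=
      hα.of_le_mul (hα.aestronglyMeasurable.mul (hmeas x).aestronglyMeasurable)
        (.of_forall hle)
    simp only [div_mul_div_comm, hsqrt]
    refine (integral_sq_empirical_mean_sub_le hg hm0).trans ?_
    rw [← integral_sq_coeFn_eq_norm_sq, ← integral_const_mul]
    refine div_le_div_of_nonneg_right ?_ m.cast_nonneg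
    refine integral_mono hg.integrable_sq (hα.integrable_sq.const_mul _) fun θ => ?_
    have h := pow_le_pow_left₀ (norm_nonneg _) (hle θ) 2
    simpa only [mul_pow, Real.norm_eq_abs, sq_abs, abs_mul] using h
  · have hint : Integrable (fun θ => α θ ^ 2 / m) P := hα.integrable_sq.div_const _
    have h (i : Fin m) : ∫ ω : Fin m → Θ, α (ω i) ^ 2 / m ∂(Measure.pi fun _ => P) =
        ∫ θ, α θ ^ 2 / m ∂P :=
      integral_comp_eval (μ := fun _ : Fin m => P) hint.aestronglyMeasurable
    have hinti (i : Fin m) :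
        Integrable (fun ω : Fin m → Θ => α (ω i) ^ 2 / m) (Measure.pi fun _ => P) :=
      integrable_comp_eval (μ := fun _ : Fin m => P) hint
    simp only [div_pow, Real.sq_sqrt m.cast_nonneg]
    rw [integral_finsetSum _ fun i _ => hinti i]
    simp only [h, integral_div, integral_sq_coeFn_eq_norm_sq, Finset.sum_const, Finset.card_univ,
      Fintype.card_fin, nsmul_eq_mul]
    field_simp
end

section
/- For every α ∈ L²(P), every x ∈ X and every y ∈ ℝ, one has E(⟨ŵ_α, Φ_m(x)⟩ − y)² ≤ (a²/m) ‖α‖²_{L²(P)} + (f_α(x) − y)². -/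
open MeasureTheory

/-- Bias-variance decomposition of the squared deviation of a sample mean from a constant. -/
lemma integral_sample_mean_sub_sq {Ω ι : Type*} [MeasurableSpace Ω] [Fintype ι] [Nonempty ι]
    {μ : Measure Ω} [IsProbabilityMeasure μ] {g : Ω → ℝ} (hg : MemLp g 2 μ) (y : ℝ) :
    ∫ ω : ι → Ω, (∑ i, g (ω i) / Fintype.card ι - y) ^ 2 ∂(Measure.pi fun _ => μ) =
      ProbabilityTheory.variance g μ / Fintype.card ι + ((∫ x, g x ∂μ) - y) ^ 2 := by
  have hn : (Fintype.card ι : ℝ) ≠ 0 := Nat.cast_ne_zero.2 Fintype.card_ne_zero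
  set n := (Fintype.card ι : ℝ)
  set ν : Measure (ι → Ω) := Measure.pi fun _ => μ with hν
  have hgn : MemLp (fun x => g x / n) 2 μ := by
    simpa only [div_eq_mul_inv] using hg.mul_const n⁻¹
  have hcoord (i : ι) : MemLp (fun ω : ι → Ω => g (ω i) / n) 2 ν :=
    hgn.comp_measurePreserving (measurePreserving_eval _ i)
  have hmean : MemLp (fun ω : ι → Ω => ∑ i, g (ω i) / n) 2 ν :=
    memLp_finsetSum _ fun i _ => hcoord i
  have hvar : ProbabilityTheory.variance (fun ω : ι → Ω => ∑ i, g (ω i) / n) ν =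
      ProbabilityTheory.variance g μ / n := by
    have h := ProbabilityTheory.variance_sum_pi (μ := fun _ : ι => μ) fun _ => hgn
    have hsum : (∑ i, fun ω : ι → Ω => g (ω i) / n) = fun ω => ∑ i, g (ω i) / n := by
      ext ω; simp
    rw [hsum] at h
    rw [h]
    simp only [div_eq_mul_inv, ProbabilityTheory.variance_mul_const, Finset.sum_const,
      Finset.card_univ, nsmul_eq_mul]
    change n * _ = _
    field_simp
  have hint : ∫ ω : ι → Ω, ∑ i, g (ω i) / n ∂ν = ∫ x, g x ∂μ := by
    rw [integral_finsetSum _ fun i _ => (hcoord i).integrable one_le_two]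
    have h (i : ι) : ∫ ω : ι → Ω, g (ω i) / n ∂ν = (∫ x, g x ∂μ) / n := by
      rw [hν, integral_comp_eval (μ := fun _ : ι => μ) (i := i) hgn.aestronglyMeasurable,
        integral_div]
    simp only [h, Finset.sum_const, Finset.card_univ, nsmul_eq_mul]
    change n * _ = _
    field_simp
  have hW := ProbabilityTheory.variance_eq_sub (hmean.sub (memLp_const y))
  simp only [Pi.sub_def, Pi.pow_def] at hW
  have hWint : ∫ ω : ι → Ω, (∑ i, g (ω i) / n - y) ∂ν = (∫ x, g x ∂μ) - y := by
    rw [integral_sub (hmean.integrable one_le_two) (integrable_const y), hint]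
    simp
  have hWvar := ProbabilityTheory.variance_sub_const hmean.aestronglyMeasurable y
  rw [hWint, hWvar, hvar] at hW
  linarith

lemma Lp_two_norm_sq_eq_integral {Ω : Type*} [MeasurableSpace Ω] {μ : Measure Ω}
    (f : Lp ℝ 2 μ) : ‖f‖ ^ 2 = ∫ x, f x ^ 2 ∂μ := by
  rw [← real_inner_self_eq_norm_sq, L2.inner_def]
  simp [pow_two]

/-- For every `α ∈ L²(P)`, `x ∈ X`, `y ∈ ℝ`:
`E(⟨ŵ_α, Φ_m(x)⟩ − y)² ≤ (a²/m) ‖α‖²_{L²(P)} + (f_α(x) − y)²`. -/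
theorem random_feature_estimate_loss_bound
    {Θ : Type*} [MeasurableSpace Θ] (P : Measure Θ) [IsProbabilityMeasure P]
    {X : Type*} (a : ℝ) (ha : 0 < a) (φ : X → Θ → ℝ)
    (hmeas : ∀ x, Measurable (φ x)) (hbound : ∀ x θ, |φ x θ| ≤ a)
    (m : ℕ) (hm : 1 ≤ m) (α : Lp ℝ 2 P) (x : X) (y : ℝ) :
    (∫ ω : Fin m → Θ,
        (∑ i, (α (ω i) / Real.sqrt m) * (φ x (ω i) / Real.sqrt m) - y) ^ 2
        ∂(Measure.pi fun _ => P)) ≤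
      a ^ 2 / m * ‖α‖ ^ 2 + ((∫ θ, α θ * φ x θ ∂P) - y) ^ 2 := by
  have hα : MemLp α 2 P := Lp.memLp α
  have hg : MemLp (fun θ => α θ * φ x θ) 2 P := by
    refine (hα.const_mul a).mono
      (hα.aestronglyMeasurable.mul (hmeas x).aestronglyMeasurable) (.of_forall fun θ => ?_)
    rw [norm_mul, norm_mul, mul_comm, Real.norm_eq_abs, Real.norm_of_nonneg ha.le]
    exact mul_le_mul_of_nonneg_right (hbound x θ) (norm_nonneg _)
  have hvar : ProbabilityTheory.variance (fun θ => α θ * φ x θ) P ≤ a ^ 2 * ‖α‖ ^ 2 := by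
    refine (ProbabilityTheory.variance_le_expectation_sq hg.aestronglyMeasurable).trans ?_
    rw [Lp_two_norm_sq_eq_integral, ← integral_const_mul]
    refine integral_mono hg.integrable_sq (hα.integrable_sq.const_mul _) fun θ => ?_
    have h : φ x θ ^ 2 ≤ a ^ 2 := sq_le_sq' (abs_le.1 (hbound x θ)).1 (abs_le.1 (hbound x θ)).2
    simp only [Pi.pow_apply, mul_pow]
    rw [mul_comm]
    exact mul_le_mul_of_nonneg_right h (sq_nonneg _)
  have : Nonempty (Fin m) := ⟨⟨0, hm⟩⟩
  have key := integral_sample_mean_sub_sq (ι := Fin m) hg y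
  rw [Fintype.card_fin] at key
  simp only [div_mul_div_comm, Real.mul_self_sqrt (Nat.cast_nonneg m)]
  rw [key, div_mul_eq_mul_div]
  gcongr
end

section
/- Let α, β ∈ L²(P) with ‖α‖_{L²(P)} ≤ R and ‖β‖_{L²(P)} ≤ R. Then for every x ∈ X, E(⟨ŵ_β, Φ_m(x)⟩ − f_β(x))² − E(⟨ŵ_α, Φ_m(x)⟩ − f_α(x))² ≤ (4 R a² / m) ‖β − α‖_{L²(P)}. -/
open MeasureTheory ProbabilityTheory

/-- Cauchy–Schwarz inequality for the covariance. -/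
theorem covariance_sq_le_variance_mul_variance {Ω : Type*} [MeasurableSpace Ω] {μ : Measure Ω}
    [IsFiniteMeasure μ] {X Y : Ω → ℝ} (hX : MemLp X 2 μ) (hY : MemLp Y 2 μ) :
    cov[X, Y; μ] ^ 2 ≤ Var[X; μ] * Var[Y; μ] := by
  have h := discrim_le_zero (a := Var[X; μ]) (b := 2 * cov[X, Y; μ]) (c := Var[Y; μ]) fun t => by
    have := variance_nonneg (t • X + Y) μ
    rw [variance_add (hX.const_smul t) hY, variance_smul, covariance_smul_left] at this
    linarith
  rw [discrim] at h
  linarith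

theorem variance_sub_variance_eq_covariance {Ω : Type*} [MeasurableSpace Ω] {μ : Measure Ω}
    [IsFiniteMeasure μ] {X Y : Ω → ℝ} (hX : MemLp X 2 μ) (hY : MemLp Y 2 μ) :
    Var[Y; μ] - Var[X; μ] = cov[Y - X, Y + X; μ] := by
  rw [covariance_sub_left hY hX (hY.add hX), covariance_add_right hY hY hX,
    covariance_add_right hX hY hX, covariance_self hY.aemeasurable,
    covariance_self hX.aemeasurable, covariance_comm X Y]
  ring

theorem memLp_coeFn_mul_of_bounded {Θ : Type*} [MeasurableSpace Θ] {P : Measure Θ} {a : ℝ}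
    {ψ : Θ → ℝ} (hψ : Measurable ψ) (hbound : ∀ θ, |ψ θ| ≤ a) (u : Lp ℝ 2 P) :
    MemLp (fun θ => u θ * ψ θ) 2 P := by
  refine (Lp.memLp u).of_le_mul (c := a)
    ((Lp.aestronglyMeasurable u).mul hψ.aestronglyMeasurable) (.of_forall fun θ => ?_)
  rw [norm_mul, mul_comm]
  exact mul_le_mul_of_nonneg_right (hbound θ) (norm_nonneg _)

theorem variance_coeFn_mul_le {Θ : Type*} [MeasurableSpace Θ] {P : Measure Θ}
    [IsProbabilityMeasure P] {a : ℝ} {ψ : Θ → ℝ} (hψ : Measurable ψ)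
    (hbound : ∀ θ, |ψ θ| ≤ a) (u : Lp ℝ 2 P) :
    Var[fun θ => u θ * ψ θ; P] ≤ (a * ‖u‖) ^ 2 := by
  have hmem := memLp_coeFn_mul_of_bounded hψ hbound u
  calc Var[fun θ => u θ * ψ θ; P] ≤ ∫ θ, (u θ * ψ θ) ^ 2 ∂P :=
        variance_le_expectation_sq hmem.aestronglyMeasurable
    _ ≤ ∫ θ, a ^ 2 * (u θ * u θ) ∂P := by
        refine integral_mono hmem.integrable_sq
          (((Lp.memLp u).integrable_mul (Lp.memLp u)).const_mul _) fun θ => ?_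
        have := sq_le_sq' (abs_le.mp (hbound θ)).1 (abs_le.mp (hbound θ)).2
        calc (u θ * ψ θ) ^ 2 = ψ θ ^ 2 * (u θ * u θ) := by ring
          _ ≤ a ^ 2 * (u θ * u θ) := mul_le_mul_of_nonneg_right this (mul_self_nonneg _)
    _ = (a * ‖u‖) ^ 2 := by
        rw [integral_const_mul, mul_pow, ← real_inner_self_eq_norm_sq, L2.inner_def]
        rfl

/-- The mean squared error of the empirical mean of `m` i.i.d. samples. -/
theorem integral_sum_div_sub_integral_sq {Θ : Type*} [MeasurableSpace Θ] {P : Measure Θ}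
    [IsProbabilityMeasure P] {g : Θ → ℝ} (hg : MemLp g 2 P) {m : ℕ} (hm : m ≠ 0) :
    ∫ ω : Fin m → Θ, (∑ i, g (ω i) / m - ∫ θ, g θ ∂P) ^ 2 ∂(Measure.pi fun _ => P) =
      Var[g; P] / m := by
  have hm' : (m : ℝ) ≠ 0 := Nat.cast_ne_zero.mpr hm
  have hcomp (i : Fin m) : MemLp (fun ω : Fin m → Θ => g (ω i)) 2 (Measure.pi fun _ => P) :=
    hg.comp_measurePreserving (measurePreserving_eval (fun _ => P) i)
  have hmean : ∫ ω : Fin m → Θ, ∑ i, g (ω i) / m ∂(Measure.pi fun _ => P) = ∫ θ, g θ ∂P := by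
    rw [integral_finsetSum _ fun i _ => ((hcomp i).integrable one_le_two).div_const _]
    simp_rw [integral_div, integral_comp_eval (μ := fun _ : Fin m => P) hg.aestronglyMeasurable]
    simp
    field_simp
  have hmeas : AEMeasurable (fun ω : Fin m → Θ => ∑ i, g (ω i) / m) (Measure.pi fun _ => P) :=
    Finset.aemeasurable_fun_sum _ fun i _ => (hcomp i).aemeasurable.div_const _
  rw [← hmean, ← variance_eq_integral hmeas]
  have hsum := variance_sum_pi (μ := fun _ : Fin m => P) (X := fun _ θ => g θ * (m : ℝ)⁻¹)
    fun _ => hg.mul_const _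
  simp_rw [variance_mul_const] at hsum
  convert hsum using 1
  · congr 1
    ext ω
    simp [div_eq_mul_inv]
  · simp
    field_simp

/-- For `α, β ∈ L²(P)` with norms bounded by `R`:
`E(⟨ŵ_β, Φ_m(x)⟩ − f_β(x))² − E(⟨ŵ_α, Φ_m(x)⟩ − f_α(x))² ≤ (4Ra²/m) ‖β − α‖_{L²(P)}`. -/
theorem variance_difference_bound
    {Θ : Type*} [MeasurableSpace Θ] (P : Measure Θ) [IsProbabilityMeasure P]
    {X : Type*} (a : ℝ) (ha : 0 < a) (R : ℝ) (hR : 0 < R) (φ : X → Θ → ℝ)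
    (hmeas : ∀ x, Measurable (φ x)) (hbound : ∀ x θ, |φ x θ| ≤ a)
    (m : ℕ) (hm : 1 ≤ m) (α β : Lp ℝ 2 P)
    (hα : ‖α‖ ≤ R) (hβ : ‖β‖ ≤ R) (x : X) :
    (∫ ω : Fin m → Θ,
        (∑ i, (β (ω i) / Real.sqrt m) * (φ x (ω i) / Real.sqrt m)
          - ∫ θ, β θ * φ x θ ∂P) ^ 2
        ∂(Measure.pi fun _ => P)) -
    (∫ ω : Fin m → Θ,
        (∑ i, (α (ω i) / Real.sqrt m) * (φ x (ω i) / Real.sqrt m)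
          - ∫ θ, α θ * φ x θ ∂P) ^ 2
        ∂(Measure.pi fun _ => P)) ≤
      4 * R * a ^ 2 / m * ‖β - α‖ := by
  have hm' : m ≠ 0 := Nat.one_le_iff_ne_zero.mp hm
  have hmul (u : Lp ℝ 2 P) : MemLp (fun θ => u θ * φ x θ) 2 P :=
    memLp_coeFn_mul_of_bounded (hmeas x) (hbound x) u
  have hdiff : Var[(fun θ => β θ * φ x θ) - fun θ => α θ * φ x θ; P] ≤ (a * ‖β - α‖) ^ 2 := by
    refine le_of_eq_of_le (variance_congr ?_)
      (variance_coeFn_mul_le (hmeas x) (hbound x) (β - α))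
    filter_upwards [Lp.coeFn_sub β α] with θ hθ
    simp only [Pi.sub_apply, hθ, sub_mul]
  have hadd : Var[(fun θ => β θ * φ x θ) + fun θ => α θ * φ x θ; P] ≤ (a * ‖β + α‖) ^ 2 := by
    refine le_of_eq_of_le (variance_congr ?_)
      (variance_coeFn_mul_le (hmeas x) (hbound x) (β + α))
    filter_upwards [Lp.coeFn_add β α] with θ hθ
    simp only [Pi.add_apply, hθ, add_mul]
  have hnorm : ‖β + α‖ ≤ 2 * R := (norm_add_le β α).trans (by linarith)
  have hvar : Var[fun θ => β θ * φ x θ; P] - Var[fun θ => α θ * φ x θ; P] ≤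
      (a * ‖β - α‖) * (a * ‖β + α‖) := by
    rw [variance_sub_variance_eq_covariance (hmul α) (hmul β)]
    refine (abs_le_of_sq_le_sq' ?_ (by positivity)).2
    rw [mul_pow]
    exact (covariance_sq_le_variance_mul_variance ((hmul β).sub (hmul α))
      ((hmul β).add (hmul α))).trans
      (mul_le_mul hdiff hadd (variance_nonneg _ _) (sq_nonneg _))
  simp_rw [div_mul_div_comm, Real.mul_self_sqrt (Nat.cast_nonneg m)]
  rw [integral_sum_div_sub_integral_sq (hmul β) hm', integral_sum_div_sub_integral_sq (hmul α) hm',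
    ← sub_div, div_mul_eq_mul_div]
  gcongr
  calc _ ≤ (a * ‖β - α‖) * (a * ‖β + α‖) := hvar
    _ ≤ (a * ‖β - α‖) * (a * (4 * R)) := by gcongr; linarith
    _ = 4 * R * a ^ 2 * ‖β - α‖ := by ring
end

section
/- (Lemma 3.) Let α, β ∈ L²(P) with ‖α‖_{L²(P)} ≤ R and ‖β‖_{L²(P)} ≤ R, let x ∈ X and y ∈ ℝ with |y| ≤ Y, and set ρ_m = a(aR + Y) + 2Ra²/m. Then E[ ½(⟨ŵ_β, Φ_m(x)⟩ − y)² − ½(⟨ŵ_α, Φ_m(x)⟩ − y)² ] ≤ ρ_m ‖β − α‖_{L²(P)}. -/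
open MeasureTheory ProbabilityTheory

section SampleMean

variable {Θ : Type*} [MeasurableSpace Θ] {P : Measure Θ} [IsProbabilityMeasure P]

lemma memLp_sampleMean {m : ℕ} {f : Θ → ℝ} (hf : MemLp f 2 P) :
    MemLp (fun ω : Fin m → Θ => (∑ i, f (ω i)) / m) 2 (Measure.pi fun _ => P) := by
  have h := memLp_finsetSum (p := 2) (μ := Measure.pi fun _ : Fin m => P) Finset.univ
    (f := fun i ω => f (ω i))
    fun i _ => hf.comp_measurePreserving (measurePreserving_eval (fun _ : Fin m => P) i)
  simpa only [div_eq_mul_inv] using h.mul_const ((m : ℝ)⁻¹)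

lemma integrable_sampleMean_sub_sq {m : ℕ} {f : Θ → ℝ} (hf : MemLp f 2 P) (y : ℝ) :
    Integrable (fun ω : Fin m → Θ => ((∑ i, f (ω i)) / m - y) ^ 2) (Measure.pi fun _ => P) :=
  ((memLp_sampleMean hf).sub (memLp_const y)).integrable_sq

lemma integral_sampleMean {m : ℕ} (hm : m ≠ 0) {f : Θ → ℝ} (hf : Integrable f P) :
    ∫ ω : Fin m → Θ, (∑ i, f (ω i)) / m ∂(Measure.pi fun _ => P) = ∫ θ, f θ ∂P := by
  have hint (i : Fin m) :
      Integrable (fun ω : Fin m → Θ => f (ω i)) (Measure.pi fun _ => P) :=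
    (measurePreserving_eval (fun _ : Fin m => P) i).integrable_comp_of_integrable hf
  have heval (i : Fin m) :
      ∫ ω : Fin m → Θ, f (ω i) ∂(Measure.pi fun _ => P) = ∫ θ, f θ ∂P := by
    have hmp := measurePreserving_eval (fun _ : Fin m => P) i
    have hmap := integral_map hmp.measurable.aemeasurable (f := f)
      (by rw [hmp.map_eq]; exact hf.aestronglyMeasurable)
    rw [hmp.map_eq] at hmap
    exact hmap.symm
  rw [integral_div, integral_finsetSum _ fun i _ => hint i]
  simp only [heval, Finset.sum_const, Finset.card_univ, Fintype.card_fin, nsmul_eq_mul]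
  field_simp

lemma integral_sampleMean_sub_sq {m : ℕ} (hm : m ≠ 0) {f : Θ → ℝ} (hf : MemLp f 2 P)
    (y : ℝ) :
    ∫ ω : Fin m → Θ, ((∑ i, f (ω i)) / m - y) ^ 2 ∂(Measure.pi fun _ => P) =
      (∫ θ, f θ ∂P - y) ^ 2 + Var[f; P] / m := by
  have hS := memLp_sampleMean (m := m) hf
  have hvar := variance_eq_sub (hS.sub (memLp_const y))
  have hmean : ∫ ω : Fin m → Θ, ((∑ i, f (ω i)) / m - y) ∂(Measure.pi fun _ => P) =
      ∫ θ, f θ ∂P - y := by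
    rw [integral_sub (hS.integrable one_le_two) (integrable_const y),
      integral_sampleMean hm (hf.integrable one_le_two)]
    simp
  have hvar' : Var[fun ω : Fin m → Θ => (∑ i, f (ω i)) / m - y; Measure.pi fun _ => P] =
      Var[f; P] / m := by
    rw [variance_sub_const hS.aestronglyMeasurable]
    have hsum := variance_sum_pi (μ := fun _ : Fin m => P) (X := fun _ => f) fun _ => hf
    simp only [div_eq_mul_inv]
    rw [variance_mul_const]
    have hfun : (fun ω : Fin m → Θ => ∑ i, f (ω i)) = ∑ i, fun ω : Fin m → Θ => f (ω i) := by
      ext ω; simp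
    rw [hfun, hsum]
    simp only [Finset.sum_const, Finset.card_univ, Fintype.card_fin, nsmul_eq_mul]
    field_simp
  change Var[fun ω : Fin m → Θ => (∑ i, f (ω i)) / m - y; Measure.pi fun _ => P] =
    ∫ ω : Fin m → Θ, ((∑ i, f (ω i)) / m - y) ^ 2 ∂(Measure.pi fun _ => P) -
      (∫ ω : Fin m → Θ, ((∑ i, f (ω i)) / m - y) ∂(Measure.pi fun _ => P)) ^ 2 at hvar
  rw [hmean, hvar'] at hvar
  linarith

end SampleMean

section LTwo

variable {Θ : Type*} [MeasurableSpace Θ] {P : Measure Θ} [IsProbabilityMeasure P]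

lemma abs_integral_le_norm_Lp_two (f : Lp ℝ 2 P) : |∫ θ, f θ ∂P| ≤ ‖f‖ := by
  have h : inner ℝ (Lp.const 2 P (1 : ℝ)) f = ∫ θ, f θ ∂P := by
    rw [L2.inner_def]
    refine integral_congr_ae ?_
    filter_upwards [Lp.coeFn_const 2 P (1 : ℝ)] with θ hθ
    rw [hθ]
    simp
  rw [← h]
  refine (abs_real_inner_le_norm _ _).trans ?_
  rw [Lp.norm_const _ _ _ two_ne_zero]
  simp

lemma variance_Lp_two (f : Lp ℝ 2 P) : Var[f; P] = ‖f‖ ^ 2 - (∫ θ, f θ ∂P) ^ 2 := by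
  rw [variance_eq_sub (Lp.memLp f), ← real_inner_self_eq_norm_sq, L2.inner_def]
  congr 1
  refine integral_congr_ae (.of_forall fun θ => ?_)
  simp [sq]

lemma integral_sampleMean_loss_sub_le {m : ℕ} (hm : m ≠ 0) {r d Y y : ℝ} (f g : Lp ℝ 2 P)
    (hf : ‖f‖ ≤ r) (hg : ‖g‖ ≤ r) (hfg : ‖g - f‖ ≤ d) (hy : |y| ≤ Y) :
    ∫ ω : Fin m → Θ, (((∑ i, g (ω i)) / m - y) ^ 2 / 2 - ((∑ i, f (ω i)) / m - y) ^ 2 / 2)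
        ∂(Measure.pi fun _ => P) ≤ (r + Y) * d + 2 * r * d / m := by
  have hm' : (0 : ℝ) < m := by positivity
  have hr : 0 ≤ r := (norm_nonneg f).trans hf
  have hd : 0 ≤ d := (norm_nonneg _).trans hfg
  have hf' := (abs_integral_le_norm_Lp_two f).trans hf
  have hg' := (abs_integral_le_norm_Lp_two g).trans hg
  have hsub : ∫ θ, (g - f : Lp ℝ 2 P) θ ∂P = ∫ θ, g θ ∂P - ∫ θ, f θ ∂P := by
    rw [integral_congr_ae (Lp.coeFn_sub g f)]
    exact integral_sub ((Lp.memLp g).integrable one_le_two) ((Lp.memLp f).integrable one_le_two)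
  have hfg' := (abs_integral_le_norm_Lp_two (g - f)).trans hfg
  rw [hsub] at hfg'
  rw [integral_sub ((integrable_sampleMean_sub_sq (Lp.memLp g) y).div_const 2)
      ((integrable_sampleMean_sub_sq (Lp.memLp f) y).div_const 2), integral_div, integral_div,
    integral_sampleMean_sub_sq hm (Lp.memLp g), integral_sampleMean_sub_sq hm (Lp.memLp f),
    variance_Lp_two, variance_Lp_two]
  set u := ∫ θ, f θ ∂P
  set v := ∫ θ, g θ ∂P
  have hbias : (v - u) * (v + u - 2 * y) ≤ d * (2 * (r + Y)) := by
    refine (le_abs_self _).trans ?_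
    rw [abs_mul]
    refine mul_le_mul hfg' ?_ (abs_nonneg _) hd
    rw [abs_le] at *
    constructor <;> linarith [hf'.1, hf'.2, hg'.1, hg'.2, hy.1, hy.2]
  have hmean : -((v - u) * (v + u)) ≤ d * (2 * r) := by
    refine (neg_le_abs _).trans ?_
    rw [abs_mul]
    refine mul_le_mul hfg' ?_ (abs_nonneg _) hd
    linarith [abs_add_le v u]
  have hnorm : (‖g‖ - ‖f‖) * (‖g‖ + ‖f‖) ≤ d * (2 * r) :=
    mul_le_mul ((norm_sub_norm_le g f).trans hfg) (by linarith) (by positivity) hd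
  have hvar : (‖g‖ ^ 2 - v ^ 2 - (‖f‖ ^ 2 - u ^ 2)) / m ≤ 4 * r * d / m := by
    gcongr
    linarith
  have hsplit : ((v - y) ^ 2 + (‖g‖ ^ 2 - v ^ 2) / m) / 2 -
      ((u - y) ^ 2 + (‖f‖ ^ 2 - u ^ 2) / m) / 2 =
      (v - u) * (v + u - 2 * y) / 2 + (‖g‖ ^ 2 - v ^ 2 - (‖f‖ ^ 2 - u ^ 2)) / m / 2 := by
    ring
  have hrhs : (r + Y) * d + 2 * r * d / m = d * (2 * (r + Y)) / 2 + 4 * r * d / m / 2 := by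
    ring
  rw [hsplit, hrhs]
  gcongr

end LTwo

/-- (Lemma 3.) For `α, β ∈ L²(P)` with norms bounded by `R`, `|y| ≤ Y` and
`ρ_m = a(aR + Y) + 2Ra²/m`:
`E[½(⟨ŵ_β, Φ_m(x)⟩ − y)² − ½(⟨ŵ_α, Φ_m(x)⟩ − y)²] ≤ ρ_m ‖β − α‖_{L²(P)}`. -/
theorem loss_variation_bound
    {Θ : Type*} [MeasurableSpace Θ] (P : Measure Θ) [IsProbabilityMeasure P]
    {X : Type*} (a : ℝ) (ha : 0 < a) (R : ℝ) (hR : 0 < R) (Y : ℝ) (hY : 0 < Y)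
    (φ : X → Θ → ℝ)
    (hmeas : ∀ x, Measurable (φ x)) (hbound : ∀ x θ, |φ x θ| ≤ a)
    (m : ℕ) (hm : 1 ≤ m) (α β : Lp ℝ 2 P) (hα : ‖α‖ ≤ R) (hβ : ‖β‖ ≤ R)
    (x : X) (y : ℝ) (hy : |y| ≤ Y) :
    (∫ ω : Fin m → Θ,
        ((∑ i, (β (ω i) / Real.sqrt m) * (φ x (ω i) / Real.sqrt m) - y) ^ 2 / 2
          - (∑ i, (α (ω i) / Real.sqrt m) * (φ x (ω i) / Real.sqrt m) - y) ^ 2 / 2)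
        ∂(Measure.pi fun _ => P)) ≤
      (a * (a * R + Y) + 2 * R * a ^ 2 / m) * ‖β - α‖ := by
  set c : ℝ := √m
  have hcc : c * c = m := Real.mul_self_sqrt (Nat.cast_nonneg m)
  have hmem (γ : Lp ℝ 2 P) : MemLp (fun θ => γ θ * φ x θ) 2 P := by
    refine (Lp.memLp γ).of_le_mul (c := a)
      ((Lp.aestronglyMeasurable γ).mul (hmeas x).aestronglyMeasurable) (.of_forall fun θ => ?_)
    rw [norm_mul, mul_comm]
    exact mul_le_mul_of_nonneg_right (hbound x θ) (norm_nonneg _)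
  have hnorm (γ δ : Lp ℝ 2 P) (h : ∀ᵐ θ ∂P, δ θ = γ θ * φ x θ) : ‖δ‖ ≤ a * ‖γ‖ := by
    refine Lp.norm_le_mul_norm_of_ae_le_mul ?_
    filter_upwards [h] with θ hθ
    rw [hθ, norm_mul, mul_comm]
    exact mul_le_mul_of_nonneg_right (hbound x θ) (norm_nonneg _)
  set f := (hmem α).toLp
  set g := (hmem β).toLp
  have hf : f =ᵐ[P] fun θ => α θ * φ x θ := (hmem α).coeFn_toLp
  have hg : g =ᵐ[P] fun θ => β θ * φ x θ := (hmem β).coeFn_toLp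
  have hfg : ‖g - f‖ ≤ a * ‖β - α‖ := by
    refine hnorm _ _ ?_
    filter_upwards [hf, hg, Lp.coeFn_sub g f, Lp.coeFn_sub β α] with θ h₁ h₂ h₃ h₄
    rw [h₃, h₄, Pi.sub_apply, Pi.sub_apply, h₁, h₂, sub_mul]
  have hsample {h k : Θ → ℝ} (hhk : h =ᵐ[P] k) :
      ∀ᵐ ω ∂(Measure.pi fun _ : Fin m => P), ∀ i, h (ω i) = k (ω i) :=
    ae_all_iff.2 fun i =>
      (measurePreserving_eval (fun _ : Fin m => P) i).quasiMeasurePreserving.ae hhk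
  have hcongr : ∀ᵐ ω ∂(Measure.pi fun _ : Fin m => P),
      (∑ i, (β (ω i) / c) * (φ x (ω i) / c) - y) ^ 2 / 2
          - (∑ i, (α (ω i) / c) * (φ x (ω i) / c) - y) ^ 2 / 2 =
        ((∑ i, g (ω i)) / m - y) ^ 2 / 2 - ((∑ i, f (ω i)) / m - y) ^ 2 / 2 := by
    filter_upwards [hsample hf, hsample hg] with ω h₁ h₂
    simp only [h₁, h₂, div_mul_div_comm, hcc, Finset.sum_div]
  rw [integral_congr_ae hcongr]
  refine (integral_sampleMean_loss_sub_le (by omega) f g (r := a * R) ?_ ?_ hfg hy).trans_eq ?_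
  · exact (hnorm α f hf).trans (by gcongr)
  · exact (hnorm β g hg).trans (by gcongr)
  · ring
end

section
/- Let γ ∈ (0,1), λ > 0, t ≥ 1, and let α, β ∈ L²(P) with ‖α‖_{L²(P)} ≤ R and ‖β‖_{L²(P)} ≤ R. Set ρ_m = a(aR + Y) + 2Ra²/m. Then E[ F_t^γ(ŵ_β) − F_t^γ(ŵ_α) ] ≤ ( λ R + ρ_m/(1−γ) ) ‖β − α‖_{L²(P)}. -/
open MeasureTheory

/-- The discounted potential `F_t^γ(w) = γ^t (λ/2)‖w‖₂² + ∑_{s=1}^t γ^{t−s} ℓ_s(w)`,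
where `ℓ_s(w) = ½(⟨w, Φ_m(x_s)⟩ − y_s)²` over the random features
`Φ_m(x)(ω) = m^{-1/2}(φ(x;ω_1),…,φ(x;ω_m))`. -/
noncomputable def discountedPotential {Θ X : Type*} (φ : X → Θ → ℝ) (m : ℕ)
    (γ lam : ℝ) (xs : ℕ → X) (ys : ℕ → ℝ) (t : ℕ)
    (w : Fin m → ℝ) (ω : Fin m → Θ) : ℝ :=
  γ ^ t * (lam / 2) * ∑ i, (w i) ^ 2
    + ∑ s ∈ Finset.Icc 1 t,
        γ ^ (t - s) * ((∑ i, w i * (φ (xs s) (ω i) / Real.sqrt m)) - ys s) ^ 2 / 2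

theorem lpNorm_mul_le_of_abs_le {Ω : Type*} [MeasurableSpace Ω] {μ : Measure Ω} {p : ENNReal}
    {f h : Ω → ℝ} {a : ℝ} (hf : MemLp f p μ) (hh : Measurable h) (hbound : ∀ x, |h x| ≤ a)
    (ha : 0 ≤ a) :
    MemLp (fun x => f x * h x) p μ ∧ lpNorm (fun x => f x * h x) p μ ≤ a * lpNorm f p μ := by
  have hle : ∀ x, ‖f x * h x‖ ≤ a * ‖f x‖ := fun x => by
    rw [norm_mul, mul_comm]
    exact mul_le_mul_of_nonneg_right (hbound x) (norm_nonneg _)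
  refine ⟨hf.of_le_mul (hf.1.mul hh.aestronglyMeasurable) (.of_forall hle), ?_⟩
  calc lpNorm (fun x => f x * h x) p μ ≤ lpNorm (a • fun x => ‖f x‖) p μ :=
        lpNorm_mono_real (hf.norm.const_smul a) hle
    _ = a * lpNorm f p μ := by
        rw [lpNorm_const_smul, lpNorm_norm hf.1]
        simp [abs_of_nonneg ha]

theorem integral_mul_le_lpNorm_two_mul_lpNorm_two {Ω : Type*} [MeasurableSpace Ω] {μ : Measure Ω}
    {f g : Ω → ℝ} (hf : MemLp f 2 μ) (hg : MemLp g 2 μ) :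
    ∫ x, f x * g x ∂μ ≤ lpNorm f 2 μ * lpNorm g 2 μ := by
  have h := real_inner_le_norm (hg.toLp g) (hf.toLp f)
  rw [L2.inner_def, Lp.norm_toLp, Lp.norm_toLp, toReal_eLpNorm hf.1, toReal_eLpNorm hg.1,
    mul_comm] at h
  refine le_of_eq_of_le (integral_congr_ae ?_) h
  filter_upwards [hf.coeFn_toLp, hg.coeFn_toLp] with x hx hy
  simp [hx, hy]

theorem lpNorm_sampleMean_le {Θ : Type*} [MeasurableSpace Θ] {P : Measure Θ}
    [IsProbabilityMeasure P] {p : ENNReal} (hp : 1 ≤ p) {m : ℕ} (hm : m ≠ 0)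
    {g : Θ → ℝ} (hg : MemLp g p P) :
    MemLp (fun ω : Fin m → Θ => (∑ i, g (ω i)) / m) p (Measure.pi fun _ => P) ∧
      lpNorm (fun ω : Fin m → Θ => (∑ i, g (ω i)) / m) p (Measure.pi fun _ => P)
        ≤ lpNorm g p P := by
  have hmp (i : Fin m) := measurePreserving_eval (fun _ : Fin m => P) i
  have hi (i : Fin m) : MemLp (fun ω : Fin m → Θ => g (ω i)) p (Measure.pi fun _ => P) :=
    hg.comp_measurePreserving (hmp i)
  have hn (i : Fin m) :
      lpNorm (fun ω : Fin m → Θ => g (ω i)) p (Measure.pi fun _ => P) = lpNorm g p P := by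
    rw [← toReal_eLpNorm (hi i).1, ← toReal_eLpNorm hg.1]
    exact congrArg _ (eLpNorm_comp_measurePreserving hg.1 (hmp i))
  have hsum : MemLp (fun ω : Fin m → Θ => ∑ i, g (ω i)) p (Measure.pi fun _ => P) :=
    memLp_finsetSum _ fun i _ => hi i
  refine ⟨by simpa only [div_eq_mul_inv] using hsum.mul_const _, ?_⟩
  rw [lpNorm_fun_div_natCast hm, div_le_iff₀ (by positivity)]
  have h := lpNorm_sum_le (s := Finset.univ) (fun i _ => hi i) hp
  simp only [hn, Finset.sum_const, Finset.card_univ, Fintype.card_fin, nsmul_eq_mul] at h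
  rw [mul_comm]
  refine le_of_eq_of_le ?_ h
  congr 1
  ext ω
  simp

theorem discountedPotential_sub {Θ X : Type*} (φ : X → Θ → ℝ) (m : ℕ)
    (γ lam : ℝ) (xs : ℕ → X) (ys : ℕ → ℝ) (t : ℕ) (f g : Θ → ℝ) (ω : Fin m → Θ) :
    discountedPotential φ m γ lam xs ys t (fun i => f (ω i) / Real.sqrt m) ω
        - discountedPotential φ m γ lam xs ys t (fun i => g (ω i) / Real.sqrt m) ω
      = γ ^ t * (lam / 2) * ((∑ i, (f (ω i) - g (ω i)) * (f (ω i) + g (ω i))) / m)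
        + ∑ s ∈ Finset.Icc 1 t, γ ^ (t - s) / 2 *
          ((∑ i, (f (ω i) - g (ω i)) * φ (xs s) (ω i)) / m *
            ((∑ i, (f (ω i) + g (ω i)) * φ (xs s) (ω i)) / m - 2 * ys s)) := by
  have hsq : Real.sqrt m * Real.sqrt m = m := Real.mul_self_sqrt (Nat.cast_nonneg m)
  have hreg (h : Θ → ℝ) :
      ∑ i, (h (ω i) / Real.sqrt m) ^ 2 = (∑ i, h (ω i) ^ 2) / m := by
    rw [Finset.sum_div]
    exact Finset.sum_congr rfl fun i _ => by rw [div_pow, sq (Real.sqrt m), hsq]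
  have hpred (h : Θ → ℝ) (s : ℕ) :
      ∑ i, h (ω i) / Real.sqrt m * (φ (xs s) (ω i) / Real.sqrt m)
        = (∑ i, h (ω i) * φ (xs s) (ω i)) / m := by
    rw [Finset.sum_div]
    exact Finset.sum_congr rfl fun i _ => by rw [div_mul_div_comm, hsq]
  have hprod : ∑ i, (f (ω i) - g (ω i)) * (f (ω i) + g (ω i))
      = ∑ i, f (ω i) ^ 2 - ∑ i, g (ω i) ^ 2 := by
    rw [← Finset.sum_sub_distrib]
    exact Finset.sum_congr rfl fun i _ => by ring
  simp only [discountedPotential, hreg, hpred, hprod]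
  simp only [add_mul _ _ (φ _ _), sub_mul _ _ (φ _ _), Finset.sum_add_distrib,
    Finset.sum_sub_distrib]
  rw [add_sub_add_comm, ← Finset.sum_sub_distrib]
  congr 1
  · ring
  · exact Finset.sum_congr rfl fun s _ => by ring

theorem sum_Icc_pow_sub_le {γ : ℝ} (h0 : 0 ≤ γ) (h1 : γ < 1) (t : ℕ) :
    ∑ s ∈ Finset.Icc 1 t, γ ^ (t - s) ≤ 1 / (1 - γ) := by
  have h : ∑ s ∈ Finset.Icc 1 t, γ ^ (t - s) = ∑ k ∈ Finset.range t, γ ^ k := by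
    refine Finset.sum_nbij' (t - ·) (t - ·) ?_ ?_ ?_ ?_ fun _ _ => rfl <;>
      simp only [Finset.mem_Icc, Finset.mem_range] <;> omega
  rw [h, one_div, ← tsum_geometric_of_lt_one h0 h1]
  exact (summable_geometric_of_lt_one h0 h1).sum_le_tsum _ fun _ _ => by positivity

theorem lpNorm_coeFn_Lp {Ω : Type*} [MeasurableSpace Ω] {μ : Measure Ω} {p : ENNReal}
    (f : Lp ℝ p μ) : lpNorm f p μ = ‖f‖ := by
  rw [← toReal_eLpNorm (Lp.aestronglyMeasurable f), Lp.norm_def]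

/-- For `γ ∈ (0,1)`, `λ > 0`, `t ≥ 1` and comparators `α, β` with `L²(P)`-norms bounded
by `R`: `E[F_t^γ(ŵ_β) − F_t^γ(ŵ_α)] ≤ (λR + ρ_m/(1−γ)) ‖β − α‖_{L²(P)}`, where
`ρ_m = a(aR + Y) + 2Ra²/m`. -/
theorem potential_variation_bound
    {Θ : Type*} [MeasurableSpace Θ] (P : Measure Θ) [IsProbabilityMeasure P]
    {X : Type*} (a : ℝ) (ha : 0 < a) (R : ℝ) (hR : 0 < R) (Y : ℝ) (hY : 0 < Y)
    (φ : X → Θ → ℝ)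
    (hmeas : ∀ x, Measurable (φ x)) (hbound : ∀ x θ, |φ x θ| ≤ a)
    (m : ℕ) (hm : 1 ≤ m)
    (γ : ℝ) (hγ : γ ∈ Set.Ioo (0 : ℝ) 1) (lam : ℝ) (hlam : 0 < lam)
    (t : ℕ) (ht : 1 ≤ t)
    (xs : ℕ → X) (ys : ℕ → ℝ) (hy : ∀ s ∈ Finset.Icc 1 t, |ys s| ≤ Y)
    (α β : Lp ℝ 2 P) (hα : ‖α‖ ≤ R) (hβ : ‖β‖ ≤ R) :
    (∫ ω : Fin m → Θ,
        (discountedPotential φ m γ lam xs ys t (fun i => β (ω i) / Real.sqrt m) ω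
          - discountedPotential φ m γ lam xs ys t (fun i => α (ω i) / Real.sqrt m) ω)
        ∂(Measure.pi fun _ => P)) ≤
      (lam * R + (a * (a * R + Y) + 2 * R * a ^ 2 / m) / (1 - γ)) * ‖β - α‖ := by
  obtain ⟨hγ0, hγ1⟩ := hγ
  have hm0 : m ≠ 0 := by omega
  set d : ℝ := ‖β - α‖ with hd
  have hd0 : 0 ≤ d := norm_nonneg _
  have hδ : MemLp (fun θ => β θ - α θ) 2 P := (Lp.memLp β).sub (Lp.memLp α)
  have hσ : MemLp (fun θ => β θ + α θ) 2 P := (Lp.memLp β).add (Lp.memLp α)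
  have hδn : lpNorm (fun θ => β θ - α θ) 2 P = d := by
    rw [hd, ← lpNorm_coeFn_Lp, ← toReal_eLpNorm hδ.1,
      ← toReal_eLpNorm (Lp.aestronglyMeasurable _)]
    exact congrArg _ (eLpNorm_congr_ae (Lp.coeFn_sub β α).symm)
  have hσn : lpNorm (fun θ => β θ + α θ) 2 P ≤ 2 * R := by
    have h : lpNorm (fun θ => β θ + α θ) 2 P ≤ lpNorm β 2 P + lpNorm α 2 P :=
      lpNorm_add_le (Lp.memLp β) one_le_two
    rw [lpNorm_coeFn_Lp, lpNorm_coeFn_Lp] at h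
    linarith
  have hreg_int : Integrable (fun θ => (β θ - α θ) * (β θ + α θ)) P := hδ.integrable_mul hσ
  have hreg_mean := (lpNorm_sampleMean_le le_rfl hm0
    (memLp_one_iff_integrable.2 hreg_int)).1.integrable le_rfl
  have hreg : ∫ ω : Fin m → Θ, (∑ i, (β (ω i) - α (ω i)) * (β (ω i) + α (ω i))) / m
      ∂(Measure.pi fun _ => P) ≤ 2 * R * d := by
    have hval (i : Fin m) : ∫ ω : Fin m → Θ, (β (ω i) - α (ω i)) * (β (ω i) + α (ω i))
        ∂(Measure.pi fun _ => P) = ∫ θ, (β θ - α θ) * (β θ + α θ) ∂P :=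
      integral_comp_eval (μ := fun _ : Fin m => P) hreg_int.aestronglyMeasurable
    have hint (i : Fin m) : Integrable
        (fun ω : Fin m → Θ => (β (ω i) - α (ω i)) * (β (ω i) + α (ω i)))
        (Measure.pi fun _ => P) :=
      (measurePreserving_eval (fun _ : Fin m => P) i).integrable_comp_of_integrable hreg_int
    rw [integral_div, integral_finsetSum _ fun i _ => hint i]
    simp only [hval, Finset.sum_const, Finset.card_univ, Fintype.card_fin, nsmul_eq_mul]
    rw [mul_div_cancel_left₀ _ (by exact_mod_cast hm0)]
    refine (integral_mul_le_lpNorm_two_mul_lpNorm_two hδ hσ).trans ?_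
    rw [hδn]
    nlinarith
  have hM (s : ℕ) := lpNorm_mul_le_of_abs_le hδ (hmeas (xs s)) (hbound (xs s)) ha.le
  have hN (s : ℕ) := lpNorm_mul_le_of_abs_le hσ (hmeas (xs s)) (hbound (xs s)) ha.le
  have hM' (s : ℕ) := lpNorm_sampleMean_le one_le_two hm0 (hM s).1
  have hN' (s : ℕ) := lpNorm_sampleMean_le one_le_two hm0 (hN s).1
  have hc (s : ℕ) : MemLp (fun _ : Fin m → Θ => 2 * ys s) 2 (Measure.pi fun _ => P) :=
    memLp_const _
  have hres (s : ℕ) := (hN' s).1.sub (hc s)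
  have hloss_int (s : ℕ) : Integrable (fun ω : Fin m → Θ => γ ^ (t - s) / 2 *
          ((∑ i, (β (ω i) - α (ω i)) * φ (xs s) (ω i)) / m *
            ((∑ i, (β (ω i) + α (ω i)) * φ (xs s) (ω i)) / m - 2 * ys s)))
      (Measure.pi fun _ => P) :=
    ((hM' s).1.integrable_mul (hres s)).const_mul _
  have hloss (s : ℕ) (hs : s ∈ Finset.Icc 1 t) :
      ∫ ω : Fin m → Θ, γ ^ (t - s) / 2 *
          ((∑ i, (β (ω i) - α (ω i)) * φ (xs s) (ω i)) / m *
            ((∑ i, (β (ω i) + α (ω i)) * φ (xs s) (ω i)) / m - 2 * ys s))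
        ∂(Measure.pi fun _ => P) ≤ γ ^ (t - s) * (a * (a * R + Y) * d) := by
    have h1 := integral_mul_le_lpNorm_two_mul_lpNorm_two (hM' s).1 (hres s)
    have h2 := lpNorm_sub_le (hN' s).1 one_le_two (g := fun _ => 2 * ys s)
    have h3 : lpNorm (fun _ : Fin m → Θ => 2 * ys s) 2 (Measure.pi fun _ => P) ≤ 2 * Y := by
      rw [lpNorm_const (by simp) (IsProbabilityMeasure.ne_zero _)]
      simpa using hy s hs
    have h4 := (hN' s).2.trans ((hN s).2.trans (mul_le_mul_of_nonneg_left hσn ha.le))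
    have h5 := (hM' s).2.trans (hM s).2
    rw [hδn] at h5
    have h6 := h1.trans (mul_le_mul h5 (h2.trans (add_le_add h4 h3)) lpNorm_nonneg
      (mul_nonneg ha.le hd0))
    rw [integral_const_mul]
    refine (mul_le_mul_of_nonneg_left h6 (by positivity)).trans_eq ?_
    ring
  simp only [discountedPotential_sub]
  rw [integral_add (hreg_mean.const_mul _) (integrable_finsetSum _ fun s _ => hloss_int s),
    integral_const_mul, integral_finsetSum _ fun s _ => hloss_int s]
  have hreg_le : γ ^ t * (lam / 2) * (∫ ω : Fin m → Θ,
      (∑ i, (β (ω i) - α (ω i)) * (β (ω i) + α (ω i))) / m ∂(Measure.pi fun _ => P))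
      ≤ lam * R * d := by
    refine (mul_le_mul_of_nonneg_left hreg (by positivity)).trans ?_
    calc γ ^ t * (lam / 2) * (2 * R * d) = γ ^ t * (lam * R * d) := by ring
      _ ≤ 1 * (lam * R * d) :=
          mul_le_mul_of_nonneg_right (pow_le_one₀ hγ0.le hγ1.le) (by positivity)
      _ = lam * R * d := one_mul _
  have hloss_le : ∑ s ∈ Finset.Icc 1 t, ∫ ω : Fin m → Θ, γ ^ (t - s) / 2 *
          ((∑ i, (β (ω i) - α (ω i)) * φ (xs s) (ω i)) / m *
            ((∑ i, (β (ω i) + α (ω i)) * φ (xs s) (ω i)) / m - 2 * ys s))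
        ∂(Measure.pi fun _ => P)
      ≤ (a * (a * R + Y) + 2 * R * a ^ 2 / m) / (1 - γ) * d := by
    refine (Finset.sum_le_sum hloss).trans ?_
    rw [← Finset.sum_mul]
    have h1γ : 0 < 1 - γ := sub_pos.2 hγ1
    calc _ ≤ 1 / (1 - γ) * (a * (a * R + Y) * d) :=
          mul_le_mul_of_nonneg_right (sum_Icc_pow_sub_le hγ0.le hγ1 t) (by positivity)
      _ = a * (a * R + Y) / (1 - γ) * d := by ring
      _ ≤ _ := by
          gcongr
          exact le_add_of_nonneg_right (by positivity)
  rw [add_mul]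
  exact add_le_add hreg_le hloss_le
end
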